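/- For every task T = (I, O, Δ), a finite sequence of completed set/get operations is a sequential execution of the generic sequential object of T — i.e., is generated from the initial state (∅, ∅) by the transition rules: set(id, x) is enabled in state (σ, τ) when id ∉ ID(σ) and σ ∪ {(id, x)} ∈ I, yielding state (σ ∪ {(id, x)}, τ); and get(id) returning y is enabled when id ∈ ID(σ), id ∉ ID(τ) and τ ∪ {(id, y)} ∈ Δ(σ), yielding state (σ, τ ∪ {(id, y)}) — if and only if the execution obtained by replacing each operation set(id, x) with the event inv(id, x) and each operation get(id):y with the event res(id, y) belongs to VE(T). In particular, the invariant τ ∈ Δ(σ) holds in every reachable state, and both set (by monotonicity of Δ) and get (by purity and chromaticity of Δ(σ)) preserve it. -/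

import Mathlib

/-- An event of an execution of a task: an invocation `inv id x` by process `id` with
input `x`, or a response `res id y` to process `id` with output `y`. -/
inductive Event (ι V W : Type) : Type
  | inv (id : ι) (x : V)
  | res (id : ι) (y : W)
deriving DecidableEq

/-- A completed operation of a set/get sequential object: `set id x` (returning void)
or `get id y` (returning the output value `y`). -/
inductive Op (ι V W : Type) : Type
  | set (id : ι) (x : V)
  | get (id : ι) (y : W)
deriving DecidableEq

variable {ι V W : Type}

/-- The map replacing each operation `set id x` with the event `inv id x` and each
operation `get id y` (returning `y`) with the event `res id y`. -/
def opToEv : Op ι V W → Event ι V W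
  | .set id x => .inv id x
  | .get id y => .res id y

/-- The list of (identifier, input) pairs of the invocations of an execution. -/
def invList (E : List (Event ι V W)) : List (ι × V) :=
  E.filterMap fun e =>
    match e with
    | .inv id x => some (id, x)
    | .res _ _ => none

/-- The list of (identifier, output) pairs of the responses of an execution. -/
def resList (E : List (Event ι V W)) : List (ι × W) :=
  E.filterMap fun e =>
    match e with
    | .inv _ _ => none
    | .res id y => some (id, y)

/-- Number of invocations by process `id` in an execution. -/
def invCount [DecidableEq ι] (id : ι) (E : List (Event ι V W)) : ℕ :=
  (invList E).countP fun p => decide (p.1 = id)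

/-- Number of responses to process `id` in an execution. -/
def resCount [DecidableEq ι] (id : ι) (E : List (Event ι V W)) : ℕ :=
  (resList E).countP fun p => decide (p.1 = id)

/-- An execution is well-formed if each identifier invokes at most once and responds
at most once, the response coming after the invocation. -/
def WellFormed [DecidableEq ι] (E : List (Event ι V W)) : Prop :=
  ∀ id : ι, invCount id E ≤ 1 ∧ resCount id E ≤ 1 ∧
    ∀ n : ℕ, resCount id (E.take n) ≤ invCount id (E.take n)

/-- The input simplex `σ_E` of an execution. -/
def sigmaF [DecidableEq ι] [DecidableEq V] (E : List (Event ι V W)) : Finset (ι × V) :=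
  (invList E).toFinset

/-- The output simplex `τ_E` of an execution. -/
def tauF [DecidableEq ι] [DecidableEq W] (E : List (Event ι V W)) : Finset (ι × W) :=
  (resList E).toFinset

/-- A simplex is chromatic: its vertices have pairwise distinct identifiers. -/
def Chromatic {α : Type} (σ : Finset (ι × α)) : Prop :=
  ∀ p ∈ σ, ∀ q ∈ σ, Prod.fst p = Prod.fst q → p = q

/-- A collection of simplexes closed under taking subsets (a complex). -/
def SubClosed {α : Type} (K : Set (Finset (ι × α))) : Prop :=
  ∀ σ ∈ K, ∀ σ' ⊆ σ, σ' ∈ K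

/-- A complex is pure of dimension `n - 1`: every simplex is contained in a simplex of
the complex with `n` vertices. -/
def PureOf {α : Type} (K : Set (Finset (ι × α))) (n : ℕ) : Prop :=
  ∀ σ ∈ K, ∃ ρ ∈ K, σ ⊆ ρ ∧ ρ.card = n

/-- `VE(T)`: the set of well-formed executions satisfying the task `T = (I, O, Δ)`:
for every prefix `E'`, `σ_{E'} ∈ I` and `τ_{E'} ∈ Δ(σ_{E'})`. -/
def VE [DecidableEq ι] [DecidableEq V] [DecidableEq W]
    (I : Set (Finset (ι × V))) (Δ : Finset (ι × V) → Set (Finset (ι × W))) :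
    Set (List (Event ι V W)) :=
  {E | WellFormed E ∧
    ∀ n : ℕ, sigmaF (E.take n) ∈ I ∧ tauF (E.take n) ∈ Δ (sigmaF (E.take n))}

/-- `TaskGen I Δ st s st'` holds when the generic sequential object of the task
`T = (I, O, Δ)` can execute, from state `st = (σ, τ)`, the sequence `s` of completed
set/get operations ending in state `st'`, according to the transition rules:
`set id x` is enabled in state `(σ, τ)` when `id ∉ ID(σ)` and `σ ∪ {(id, x)} ∈ I`,
yielding state `(σ ∪ {(id, x)}, τ)`; and `get id` returning `y` is enabled when
`id ∈ ID(σ)`, `id ∉ ID(τ)` and `τ ∪ {(id, y)} ∈ Δ(σ)`, yielding state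
`(σ, τ ∪ {(id, y)})`. -/
inductive TaskGen [DecidableEq ι] [DecidableEq V] [DecidableEq W]
    (I : Set (Finset (ι × V))) (Δ : Finset (ι × V) → Set (Finset (ι × W))) :
    Finset (ι × V) × Finset (ι × W) → List (Op ι V W) →
      Finset (ι × V) × Finset (ι × W) → Prop
  | nil (st : Finset (ι × V) × Finset (ι × W)) : TaskGen I Δ st [] st
  | set {σ : Finset (ι × V)} {τ : Finset (ι × W)} {s : List (Op ι V W)}
      {st' : Finset (ι × V) × Finset (ι × W)} (id : ι) (x : V)
      (h1 : id ∉ σ.image Prod.fst) (h2 : insert (id, x) σ ∈ I)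
      (h3 : TaskGen I Δ (insert (id, x) σ, τ) s st') :
      TaskGen I Δ (σ, τ) (Op.set id x :: s) st'
  | get {σ : Finset (ι × V)} {τ : Finset (ι × W)} {s : List (Op ι V W)}
      {st' : Finset (ι × V) × Finset (ι × W)} (id : ι) (y : W)
      (h1 : id ∈ σ.image Prod.fst) (h2 : id ∉ τ.image Prod.fst)
      (h3 : insert (id, y) τ ∈ Δ σ)
      (h4 : TaskGen I Δ (σ, insert (id, y) τ) s st') :
      TaskGen I Δ (σ, τ) (Op.get id y :: s) st'

theorem forall_take_append_singleton {α : Type*} (P : List α → Prop) (l : List α) (a : α) :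
    (∀ n, P ((l ++ [a]).take n)) ↔ (∀ n, P (l.take n)) ∧ P (l ++ [a]) := by
  constructor
  · refine fun h => ⟨fun n => ?_, List.take_length (l := l ++ [a]) ▸ h (l ++ [a]).length⟩
    have := h (min n l.length)
    rw [List.take_append_of_le_length (min_le_right _ _)] at this
    rwa [List.take_eq_take_min]
  · rintro ⟨h, ha⟩ n
    rcases Nat.lt_or_ge l.length n with hn | hn
    · rwa [List.take_of_length_le (by simpa using hn)]
    · rw [List.take_append_of_le_length hn]
      exact h n

section Counting

variable [DecidableEq ι] (E : List (Event ι V W)) (k id : ι) (x : V) (y : W)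

theorem invCount_append_inv :
    invCount k (E ++ [.inv id x]) = invCount k E + if id = k then 1 else 0 := by
  simp [invCount, invList, List.countP_cons]

theorem invCount_append_res : invCount k (E ++ [.res id y]) = invCount k E := by
  simp [invCount, invList]

theorem resCount_append_inv : resCount k (E ++ [.inv id x]) = resCount k E := by
  simp [resCount, resList]

theorem resCount_append_res :
    resCount k (E ++ [.res id y]) = resCount k E + if id = k then 1 else 0 := by
  simp [resCount, resList, List.countP_cons]

theorem sigmaF_append_inv [DecidableEq V] :
    sigmaF (E ++ [.inv id x]) = insert (id, x) (sigmaF E) := by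
  ext
  simp [sigmaF, invList]

theorem sigmaF_append_res [DecidableEq V] : sigmaF (E ++ [.res id y]) = sigmaF E := by
  simp [sigmaF, invList]

theorem tauF_append_inv [DecidableEq W] : tauF (E ++ [.inv id x]) = tauF E := by
  simp [tauF, resList]

theorem tauF_append_res [DecidableEq W] :
    tauF (E ++ [.res id y]) = insert (id, y) (tauF E) := by
  ext
  simp [tauF, resList]

theorem invCount_pos_iff [DecidableEq V] :
    0 < invCount id E ↔ id ∈ (sigmaF E).image Prod.fst := by
  simp [invCount, sigmaF, List.countP_pos_iff]

theorem resCount_pos_iff [DecidableEq W] :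
    0 < resCount id E ↔ id ∈ (tauF E).image Prod.fst := by
  simp [resCount, tauF, List.countP_pos_iff]

variable {E}

theorem WellFormed.resCount_le_invCount (h : WellFormed E) : resCount k E ≤ invCount k E := by
  simpa using (h k).2.2 E.length

theorem wellFormed_append_singleton (e : Event ι V W) :
    WellFormed (E ++ [e]) ↔ ∀ k, invCount k (E ++ [e]) ≤ 1 ∧ resCount k (E ++ [e]) ≤ 1 ∧
      (∀ n, resCount k (E.take n) ≤ invCount k (E.take n)) ∧
      resCount k (E ++ [e]) ≤ invCount k (E ++ [e]) :=
  forall_congr' fun k => and_congr_right' <| and_congr_right' <|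
    forall_take_append_singleton (fun l => resCount k l ≤ invCount k l) E e

theorem wellFormed_append_inv [DecidableEq V] :
    WellFormed (E ++ [.inv id x]) ↔ WellFormed E ∧ id ∉ (sigmaF E).image Prod.fst := by
  rw [← invCount_pos_iff]
  simp only [wellFormed_append_singleton, invCount_append_inv, resCount_append_inv]
  constructor
  · refine fun h => ⟨fun k => ?_, ?_⟩
    · obtain ⟨h1, h2, h3, -⟩ := h k
      exact ⟨by omega, h2, h3⟩
    · have := (h id).1
      simp only [if_true] at this
      omega
  · rintro ⟨h, hid⟩ k
    obtain ⟨h1, h2, h3⟩ := h k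
    have := WellFormed.resCount_le_invCount k h
    refine ⟨?_, h2, h3, by omega⟩
    split_ifs with hk
    · subst hk
      omega
    · omega

theorem wellFormed_append_res [DecidableEq V] [DecidableEq W] :
    WellFormed (E ++ [.res id y]) ↔ WellFormed E ∧
      id ∈ (sigmaF E).image Prod.fst ∧ id ∉ (tauF E).image Prod.fst := by
  rw [← invCount_pos_iff, ← resCount_pos_iff]
  simp only [wellFormed_append_singleton, invCount_append_res, resCount_append_res]
  constructor
  · refine fun h => ⟨fun k => ?_, ?_⟩
    · obtain ⟨h1, h2, h3, -⟩ := h k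
      exact ⟨h1, by omega, h3⟩
    · obtain ⟨-, h2, -, h4⟩ := h id
      simp only [if_true] at h2 h4
      omega
  · rintro ⟨h, hinv, hres⟩ k
    obtain ⟨h1, h2, h3⟩ := h k
    have := WellFormed.resCount_le_invCount k h
    refine ⟨h1, ?_, h3, ?_⟩ <;>
    · split_ifs with hk
      · subst hk
        omega
      · omega

end Counting

section Executions

variable [DecidableEq ι] [DecidableEq V] [DecidableEq W]
  {I : Set (Finset (ι × V))} {Δ : Finset (ι × V) → Set (Finset (ι × W))}

theorem mem_VE_append_singleton (E : List (Event ι V W)) (e : Event ι V W)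
    (hwf : WellFormed (E ++ [e]) → WellFormed E) :
    E ++ [e] ∈ VE I Δ ↔ E ∈ VE I Δ ∧ WellFormed (E ++ [e]) ∧
      sigmaF (E ++ [e]) ∈ I ∧ tauF (E ++ [e]) ∈ Δ (sigmaF (E ++ [e])) := by
  simp only [VE, Set.mem_ofPred_eq,
    forall_take_append_singleton (fun l => sigmaF l ∈ I ∧ tauF l ∈ Δ (sigmaF l))]
  tauto

theorem sigma_tau_mem_of_mem_VE {E : List (Event ι V W)} (h : E ∈ VE I Δ) :
    sigmaF E ∈ I ∧ tauF E ∈ Δ (sigmaF E) := by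
  simpa using h.2 E.length

theorem append_inv_mem_VE (hmono : ∀ σ ∈ I, ∀ σ' ∈ I, σ' ⊆ σ → Δ σ' ⊆ Δ σ)
    (E : List (Event ι V W)) (id : ι) (x : V) :
    E ++ [.inv id x] ∈ VE I Δ ↔ E ∈ VE I Δ ∧ id ∉ (sigmaF E).image Prod.fst ∧
      insert (id, x) (sigmaF E) ∈ I := by
  rw [mem_VE_append_singleton _ _ fun h => ((wellFormed_append_inv id x).1 h).1,
    wellFormed_append_inv, sigmaF_append_inv, tauF_append_inv]
  constructor
  · rintro ⟨hE, ⟨-, hid⟩, hI, -⟩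
    exact ⟨hE, hid, hI⟩
  · rintro ⟨hE, hid, hI⟩
    have hστ := sigma_tau_mem_of_mem_VE hE
    exact ⟨hE, ⟨hE.1, hid⟩, hI, hmono _ hI _ hστ.1 (Finset.subset_insert _ _) hστ.2⟩

theorem append_res_mem_VE (E : List (Event ι V W)) (id : ι) (y : W) :
    E ++ [.res id y] ∈ VE I Δ ↔ E ∈ VE I Δ ∧ id ∈ (sigmaF E).image Prod.fst ∧
      id ∉ (tauF E).image Prod.fst ∧ insert (id, y) (tauF E) ∈ Δ (sigmaF E) := by
  rw [mem_VE_append_singleton _ _ fun h => ((wellFormed_append_res id y).1 h).1,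
    wellFormed_append_res, sigmaF_append_res, tauF_append_res]
  constructor
  · rintro ⟨hE, ⟨-, hσ, hτ⟩, -, hΔ⟩
    exact ⟨hE, hσ, hτ, hΔ⟩
  · rintro ⟨hE, hσ, hτ, hΔ⟩
    exact ⟨hE, ⟨hE.1, hσ, hτ⟩, (sigma_tau_mem_of_mem_VE hE).1, hΔ⟩

theorem nil_mem_VE (hI : ∅ ∈ I) (hΔ : ∅ ∈ Δ ∅) : ([] : List (Event ι V W)) ∈ VE I Δ :=
  ⟨fun _ => by simp [invCount, invList, resCount, resList],
    fun _ => by simpa [sigmaF, invList, tauF, resList] using ⟨hI, hΔ⟩⟩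

theorem taskGen_nil_iff {st st' : Finset (ι × V) × Finset (ι × W)} :
    TaskGen I Δ st [] st' ↔ st' = st :=
  ⟨fun h => by cases h; rfl, fun h => h ▸ .nil _⟩

theorem taskGen_set_iff {σ : Finset (ι × V)} {τ : Finset (ι × W)}
    {st : Finset (ι × V) × Finset (ι × W)} {id : ι} {x : V} {s : List (Op ι V W)} :
    TaskGen I Δ (σ, τ) (.set id x :: s) st ↔ id ∉ σ.image Prod.fst ∧
      insert (id, x) σ ∈ I ∧ TaskGen I Δ (insert (id, x) σ, τ) s st :=
  ⟨fun h => by cases h; exact ⟨‹_›, ‹_›, ‹_›⟩, fun ⟨h1, h2, h3⟩ => .set id x h1 h2 h3⟩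

theorem taskGen_get_iff {σ : Finset (ι × V)} {τ : Finset (ι × W)}
    {st : Finset (ι × V) × Finset (ι × W)} {id : ι} {y : W} {s : List (Op ι V W)} :
    TaskGen I Δ (σ, τ) (.get id y :: s) st ↔ id ∈ σ.image Prod.fst ∧
      id ∉ τ.image Prod.fst ∧ insert (id, y) τ ∈ Δ σ ∧
        TaskGen I Δ (σ, insert (id, y) τ) s st :=
  ⟨fun h => by cases h; exact ⟨‹_›, ‹_›, ‹_›, ‹_›⟩,
    fun ⟨h1, h2, h3, h4⟩ => .get id y h1 h2 h3 h4⟩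

theorem taskGen_append_iff {st st' : Finset (ι × V) × Finset (ι × W)} {s t : List (Op ι V W)} :
    TaskGen I Δ st (s ++ t) st' ↔ ∃ mid, TaskGen I Δ st s mid ∧ TaskGen I Δ mid t st' := by
  induction s generalizing st with
  | nil => simp [taskGen_nil_iff]
  | cons op s ih =>
    obtain ⟨σ, τ⟩ := st
    cases op with
    | set id x => simp only [List.cons_append, taskGen_set_iff, ih]; grind
    | get id y => simp only [List.cons_append, taskGen_get_iff, ih]; grind

/-- An operation sequence leads from the initial state to `st` exactly when its events form an
execution in `VE(T)` whose input and output simplexes make up `st`. -/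
theorem taskGen_iff_mem_VE (hI : ∅ ∈ I) (hΔ : ∅ ∈ Δ ∅)
    (hmono : ∀ σ ∈ I, ∀ σ' ∈ I, σ' ⊆ σ → Δ σ' ⊆ Δ σ) (s : List (Op ι V W))
    (st : Finset (ι × V) × Finset (ι × W)) :
    TaskGen I Δ (∅, ∅) s st ↔ s.map opToEv ∈ VE I Δ ∧
      st = (sigmaF (s.map opToEv), tauF (s.map opToEv)) := by
  induction s using List.reverseRecOn generalizing st with
  | nil =>
    simp [taskGen_nil_iff, nil_mem_VE hI hΔ, sigmaF, tauF, invList, resList]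
  | append_singleton s op ih =>
    simp only [taskGen_append_iff, ih, List.map_append, List.map_cons, List.map_nil,
      and_assoc, exists_and_left, exists_eq_left]
    cases op with
    | set id x =>
      simp only [opToEv, append_inv_mem_VE hmono, taskGen_set_iff, taskGen_nil_iff,
        sigmaF_append_inv, tauF_append_inv, and_assoc]
    | get id y =>
      simp only [opToEv, append_res_mem_VE, taskGen_get_iff, taskGen_nil_iff,
        sigmaF_append_res, tauF_append_res, and_assoc]

end Executions

/-- For every task `T = (I, O, Δ)` (with `I` and each `Δ σ` nonempty complexes),
a finite sequence of completed set/get operations is a sequential execution of the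
generic sequential object of `T` — generated from the initial state `(∅, ∅)` by the
transition rules — if and only if the execution obtained by replacing each `set id x`
with `inv id x` and each `get id : y` with `res id y` belongs to `VE(T)`.
In particular, the invariant `τ ∈ Δ σ` (together with `σ ∈ I`) holds in every
reachable state: it is preserved by `set` (by monotonicity of `Δ`) and by `get` (by
purity and chromaticity of `Δ σ`). -/
theorem generic_setget_object_models_task
    {ι V W : Type} [DecidableEq ι] [DecidableEq V] [DecidableEq W] (n : ℕ)
    (I : Set (Finset (ι × V))) (O : Set (Finset (ι × W)))
    (Δ : Finset (ι × V) → Set (Finset (ι × W)))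
    (hIchrom : ∀ σ ∈ I, Chromatic σ) (hOchrom : ∀ τ ∈ O, Chromatic τ)
    (hIclosed : SubClosed I) (hOclosed : SubClosed O)
    (hIpure : PureOf I n) (hOpure : PureOf O n)
    (hIne : I.Nonempty)
    (hΔO : ∀ σ ∈ I, Δ σ ⊆ O)
    (hΔclosed : ∀ σ ∈ I, ∀ τ ∈ Δ σ, ∀ τ' ⊆ τ, τ' ∈ Δ σ)
    (hΔne : ∀ σ ∈ I, (Δ σ).Nonempty)
    (hΔpure : ∀ σ ∈ I, ∀ τ ∈ Δ σ, ∃ ρ ∈ Δ σ, τ ⊆ ρ ∧ ρ.card = σ.card)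
    (hΔchrom : ∀ σ ∈ I, ∀ τ ∈ Δ σ, τ.card = σ.card →
      τ.image Prod.fst = σ.image Prod.fst)
    (hΔmono : ∀ σ ∈ I, ∀ σ' ∈ I, σ' ⊆ σ → Δ σ' ⊆ Δ σ) :
    (∀ s : List (Op ι V W),
      (∃ st, TaskGen I Δ (∅, ∅) s st) ↔ s.map opToEv ∈ VE I Δ) ∧
    (∀ (s : List (Op ι V W)) (st : Finset (ι × V) × Finset (ι × W)),
      TaskGen I Δ (∅, ∅) s st → st.1 ∈ I ∧ st.2 ∈ Δ st.1) := by
  obtain ⟨σ, hσ⟩ := hIne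
  have hI : ∅ ∈ I := hIclosed σ hσ ∅ (Finset.empty_subset σ)
  obtain ⟨τ, hτ⟩ := hΔne ∅ hI
  have hΔ : ∅ ∈ Δ ∅ := hΔclosed ∅ hI τ hτ ∅ (Finset.empty_subset τ)
  refine ⟨fun s => ?_, fun s st h => ?_⟩
  · simp [taskGen_iff_mem_VE hI hΔ hΔmono]
  · obtain ⟨hs, rfl⟩ := (taskGen_iff_mem_VE hI hΔ hΔmono s st).1 h
    exact sigma_tau_mem_of_mem_VE hs
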